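/- In the setting of the long code test 𝒯₂ with u, v, w fixed, let f_w : {0,1}^{2R} → {−1, +1}, let γ ∈ (0, 1), let U be the Markov operator mapping functions of y_k to functions of (X, Y_{−k}) defined by (Ug)(X, Y_{−k}) := E_{𝒯₂}[ g(y_k) | X, Y_{−k} ], and let G := U((I − T_{1−γ}) f_w). Let G = Σ_{α ⊆ [L]} G_α be the Efron–Stein decomposition of G with respect to the block structure in which block i ∈ [L] consists of the coordinates B_{uv}(i) ∪ B'_{uv}(i) of X and B_{uw}(i) ∪ B'_{uw}(i) of Y_{−k}. Then for every α ⊆ [L]: ‖G_α‖₂² ≤ (1 − ε)^{|α|} · Σ_{β ⊆ [2R] : π̃_{uw}(β) = α} (1 − (1 − γ)^{2|β|}) · f̂_w(β)², where the norm is with respect to the marginal of 𝒯₂, f̂_w(β) are the Fourier coefficients of f_w over the uniform distribution on {0,1}^{2R}, and π̃_{uw}(β) := { i ∈ [L] : ∃ j ∈ [R], (j ∈ β or j + R ∈ β) and π_{uw}(j) = i }. -/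

import Mathlib

open Finset

/-! Common setup for the long code test `𝒯₂` of Dinur–Kol / this paper.

A Label-Cover instance consists of a bipartite graph on `U × V` given by a Boolean
adjacency relation `Adj`, with projections `π u v : Fin R → Fin L`; we assume `R = d·L`
and that all fibers `π_{uv}^{-1}(i)` have size `d`.  Long-code strings in `{0,1}^{2R}`
are indexed by `Fin R ⊕ Fin R` (`Sum.inl j` is position `j ∈ [R]`, `Sum.inr j` is
position `j + R`). -/

/-- Choose `P1` if `b = true`, else `P0`. -/
def pick {k : ℕ} (P0 P1 : (Fin k → Bool) → ℝ) (b : Bool) : (Fin k → Bool) → ℝ :=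
  if b = true then P1 else P0

/-- The fiber `π_{uv}^{-1}(i) ⊆ [R]`. -/
def fib {U V : Type} {L R : ℕ} (π : U → V → Fin R → Fin L) (u : U) (v : V) (i : Fin L) :
    Finset (Fin R) :=
  univ.filter (fun j => π u v j = i)

/-- Mass contributed by block `i ∈ [L]` of the test `𝒯₂` for fixed `u, v, w`:
a uniform bit `c₁` decides whether the `X`-columns of the block (of both halves,
`B_{uv}(i)` and `B'_{uv}(i)`) are i.i.d. `𝒫₀` and the `Y`-columns i.i.d. `𝒫₁`, or vice
versa; then independently with probability `1 − 2ε` nothing is changed, with probability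
`ε` the primed halves `(X|_{B'_{uv}(i)}, Y|_{B'_{uw}(i)})` are resampled uniformly, and
with probability `ε` the unprimed halves are resampled uniformly. -/
noncomputable def blockM {U V : Type} {k L R : ℕ} (π : U → V → Fin R → Fin L)
    (ε : ℝ) (P0 P1 : (Fin k → Bool) → ℝ) (d : ℕ) (u : U) (v w : V) (i : Fin L)
    (X Y : Fin k → (Fin R ⊕ Fin R) → Bool) : ℝ :=
  (1 / 2) * ∑ b : Bool,
    ((1 - 2 * ε) *
        ((∏ j ∈ fib π u v i,
            pick P0 P1 b (fun r => X r (Sum.inl j)) * pick P0 P1 b (fun r => X r (Sum.inr j))) *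
         (∏ j ∈ fib π u w i,
            pick P0 P1 (!b) (fun r => Y r (Sum.inl j)) * pick P0 P1 (!b) (fun r => Y r (Sum.inr j))))
     + ε * ((∏ j ∈ fib π u v i, pick P0 P1 b (fun r => X r (Sum.inl j))) *
            (∏ j ∈ fib π u w i, pick P0 P1 (!b) (fun r => Y r (Sum.inl j)))) *
          ((1 : ℝ) / 2 ^ k) ^ (2 * d)
     + ε * ((∏ j ∈ fib π u v i, pick P0 P1 b (fun r => X r (Sum.inr j))) *
            (∏ j ∈ fib π u w i, pick P0 P1 (!b) (fun r => Y r (Sum.inr j)))) *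
          ((1 : ℝ) / 2 ^ k) ^ (2 * d))

/-- Mass of the pair of matrices `(X, Y)` under the test `𝒯₂` for fixed `u, v, w`:
the blocks `i ∈ [L]` are independent. -/
noncomputable def massT2 {U V : Type} {k L R : ℕ} (π : U → V → Fin R → Fin L)
    (ε : ℝ) (P0 P1 : (Fin k → Bool) → ℝ) (d : ℕ) (u : U) (v w : V)
    (X Y : Fin k → (Fin R ⊕ Fin R) → Bool) : ℝ :=
  ∏ i : Fin L, blockM π ε P0 P1 d u v w i X Y

/-- Expectation over `(X, Y) ∼ 𝒯₂` (for fixed `u, v, w`) of a function of the two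
matrices. -/
noncomputable def ET2 {U V : Type} {k L R : ℕ} (π : U → V → Fin R → Fin L)
    (ε : ℝ) (P0 P1 : (Fin k → Bool) → ℝ) (d : ℕ) (u : U) (v w : V)
    (h : (Fin k → (Fin R ⊕ Fin R) → Bool) → (Fin k → (Fin R ⊕ Fin R) → Bool) → ℝ) : ℝ :=
  ∑ X : Fin k → (Fin R ⊕ Fin R) → Bool, ∑ Y : Fin k → (Fin R ⊕ Fin R) → Bool,
    massT2 π ε P0 P1 d u v w X Y * h X Y

/-- The neighbors of `u ∈ U` in the bipartite graph. -/
def nbr {U V : Type} [Fintype V] (Adj : U → V → Bool) (u : U) : Finset V :=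
  univ.filter (fun v => Adj u v = true)

/-- Expectation over a uniform `u ∈ U` and uniform independent neighbors `v, w` of `u`. -/
noncomputable def Euvw {U V : Type} [Fintype U] [Fintype V] (Adj : U → V → Bool)
    (h : U → V → V → ℝ) : ℝ :=
  (1 / (Fintype.card U : ℝ)) * ∑ u : U, (1 / ((nbr Adj u).card : ℝ) ^ 2) *
    ∑ v ∈ nbr Adj u, ∑ w ∈ nbr Adj u, h u v w

/-- The Fourier character `χ_β` on `{0,1}^{2R}` (bits identified with `±1`). -/
def chi {R : ℕ} (β : Finset (Fin R ⊕ Fin R)) (x : (Fin R ⊕ Fin R) → Bool) : ℝ :=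
  ∏ c ∈ β, (if x c = true then (-1 : ℝ) else 1)

/-- The Fourier coefficient `f̂(β)` of `f : {0,1}^{2R} → ℝ` over the uniform
distribution. -/
noncomputable def fhat {R : ℕ} (f : ((Fin R ⊕ Fin R) → Bool) → ℝ)
    (β : Finset (Fin R ⊕ Fin R)) : ℝ :=
  (∑ x : (Fin R ⊕ Fin R) → Bool, f x * chi β x) / (2 : ℝ) ^ (2 * R)

/-- The noise operator `T_{1-γ} f = Σ_β (1-γ)^{|β|} f̂(β) χ_β`. -/
noncomputable def noiseT {R : ℕ} (γ : ℝ) (f : ((Fin R ⊕ Fin R) → Bool) → ℝ) :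
    ((Fin R ⊕ Fin R) → Bool) → ℝ :=
  fun x => ∑ β : Finset (Fin R ⊕ Fin R), (1 - γ) ^ β.card * fhat f β * chi β x

/-- `π̃_{uv}(β) := {i ∈ [L] : ∃ j ∈ [R], (j ∈ β ∨ j + R ∈ β) ∧ π_{uv}(j) = i}`. -/
def ptil {U V : Type} {L R : ℕ} (π : U → V → Fin R → Fin L) (u : U) (v : V)
    (β : Finset (Fin R ⊕ Fin R)) : Finset (Fin L) :=
  univ.filter (fun i => ∃ j : Fin R, (Sum.inl j ∈ β ∨ Sum.inr j ∈ β) ∧ π u v j = i)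

/-- The grouped influence `Inf̄ᵘ_i[f] = Σ_{α : i ∈ π̃_{uv}(α)} f̂(α)²`. -/
noncomputable def gInf {U V : Type} {L R : ℕ} (π : U → V → Fin R → Fin L) (u : U) (v : V)
    (f : ((Fin R ⊕ Fin R) → Bool) → ℝ) (i : Fin L) : ℝ :=
  ∑ β ∈ univ.filter (fun β : Finset (Fin R ⊕ Fin R) => i ∈ ptil π u v β), (fhat f β) ^ 2

attribute [local instance] Classical.propDecidable

/-- Extend a tuple of `k-1` rows by a last row `yk` to a tuple of `k` rows. -/
def extRow {α : Type} {k : ℕ} (Ym : Fin (k - 1) → α) (yk : α) : Fin k → α :=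
  fun j => if h : (j : ℕ) < k - 1 then Ym ⟨(j : ℕ), h⟩ else yk

/-- Marginal of `𝒯₂` (for fixed `u, v, w`) on `(X, Y_{-k})`. -/
noncomputable def margT2 {U V : Type} {k L R : ℕ} (π : U → V → Fin R → Fin L)
    (ε : ℝ) (P0 P1 : (Fin k → Bool) → ℝ) (d : ℕ) (u : U) (v w : V)
    (z : (Fin k → (Fin R ⊕ Fin R) → Bool) × (Fin (k - 1) → (Fin R ⊕ Fin R) → Bool)) : ℝ :=
  ∑ yk : (Fin R ⊕ Fin R) → Bool, massT2 π ε P0 P1 d u v w z.1 (extRow z.2 yk)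

/-- The Markov operator `U`: `(Ug)(X, Y_{-k}) = E_{𝒯₂}[g(y_k) ∣ X, Y_{-k}]`. -/
noncomputable def markovT2 {U V : Type} {k L R : ℕ} (π : U → V → Fin R → Fin L)
    (ε : ℝ) (P0 P1 : (Fin k → Bool) → ℝ) (d : ℕ) (u : U) (v w : V)
    (g : ((Fin R ⊕ Fin R) → Bool) → ℝ)
    (z : (Fin k → (Fin R ⊕ Fin R) → Bool) × (Fin (k - 1) → (Fin R ⊕ Fin R) → Bool)) : ℝ :=
  (∑ yk : (Fin R ⊕ Fin R) → Bool,
      massT2 π ε P0 P1 d u v w z.1 (extRow z.2 yk) * g yk) / margT2 π ε P0 P1 d u v w z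

/-- The block (element of `[L]`) to which a string coordinate belongs (for the pair
`(u, v)`): both position `j` and position `j + R` belong to block `π_{uv}(j)`. -/
def blockOf {U V : Type} {L R : ℕ} (π : U → V → Fin R → Fin L) (u : U) (v : V) :
    (Fin R ⊕ Fin R) → Fin L
  | Sum.inl j => π u v j
  | Sum.inr j => π u v j

/-- Two points `(X, Y_{-k})`, `(X', Y'_{-k})` agree on the blocks in `α ⊆ [L]` (the `X`-part
is grouped via `π_{uv}`, the `Y`-part via `π_{uw}`). -/
def agreeBlocks {U V : Type} {k L R : ℕ} (π : U → V → Fin R → Fin L) (u : U) (v w : V)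
    (α : Finset (Fin L))
    (z z' : (Fin k → (Fin R ⊕ Fin R) → Bool) × (Fin (k - 1) → (Fin R ⊕ Fin R) → Bool)) :
    Prop :=
  (∀ c : Fin R ⊕ Fin R, blockOf π u v c ∈ α → ∀ r : Fin k, z.1 r c = z'.1 r c) ∧
  (∀ c : Fin R ⊕ Fin R, blockOf π u w c ∈ α → ∀ r : Fin (k - 1), z.2 r c = z'.2 r c)

section FunctionSums

/-- Functions of disjoint sets of coordinates are independent under the uniform measure. -/
lemma sum_mul_sum_eq_card_mul_sum {C A : Type*} [Fintype C] [DecidableEq C] [Fintype A]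
    (p : C → Prop) (F H : (C → A) → ℝ)
    (hF : ∀ x y, (∀ c, p c → x c = y c) → F x = F y)
    (hH : ∀ x y, (∀ c, ¬ p c → x c = y c) → H x = H y) :
    (∑ x, F x) * (∑ x, H x) = (Fintype.card (C → A) : ℝ) * ∑ x, F x * H x := by
  let mix : (C → A) × (C → A) → (C → A) × (C → A) := fun q =>
    (fun c => if p c then q.1 c else q.2 c, fun c => if p c then q.2 c else q.1 c)
  have hmix : Function.Involutive mix := by
    rintro ⟨x, y⟩
    refine Prod.ext ?_ ?_ <;> funext c <;> by_cases hc : p c <;> simp [mix, hc]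
  calc (∑ x, F x) * (∑ x, H x)
      = ∑ q : (C → A) × (C → A), F q.1 * H q.2 := by
        rw [Finset.sum_mul_sum, Fintype.sum_prod_type]
    _ = ∑ q : (C → A) × (C → A), F (mix q).1 * H (mix q).1 := by
        refine Finset.sum_congr rfl fun q _ => ?_
        rw [hF q.1 (mix q).1 fun c hc => by simp [mix, hc],
          hH q.2 (mix q).1 fun c hc => by simp [mix, hc]]
    _ = ∑ q : (C → A) × (C → A), F q.1 * H q.1 :=
        Equiv.sum_comp hmix.toPerm fun q => F q.1 * H q.1
    _ = _ := by
        rw [Fintype.sum_prod_type]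
        simp [Finset.mul_sum]

/-- A sum over functions of a product of one-coordinate terms factors. -/
lemma sum_prod_apply {C A : Type*} [Fintype C] [DecidableEq C] [Fintype A] (g : C → A → ℝ) :
    ∑ x : C → A, ∏ s, g s (x s) = ∏ s, ∑ a, g s a := by
  rw [Finset.prod_univ_sum, Fintype.piFinset_univ]

/-- The sum over matrices of a product of column terms factors. -/
lemma sum_prod_columns {C A ι : Type*} [Fintype C] [DecidableEq C] [Fintype A] [Fintype ι]
    [DecidableEq ι] (g : C → (ι → A) → ℝ) :
    ∑ M : ι → C → A, ∏ s, g s (fun r => M r s) = ∏ s, ∑ a, g s a := by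
  rw [← sum_prod_apply]
  exact Equiv.sum_comp (Equiv.piComm fun (_ : ι) (_ : C) => A) fun N => ∏ s, g s (N s)

/-- If one column term sums to zero and `H` ignores that column, the weighted sum vanishes. -/
lemma sum_prod_columns_mul_eq_zero {C A ι : Type*} [Fintype C] [DecidableEq C] [Fintype A]
    [Nonempty A] [Fintype ι] [DecidableEq ι] (g : C → (ι → A) → ℝ) (H : (ι → C → A) → ℝ) (s₀ : C)
    (hg : ∑ a, g s₀ a = 0)
    (hH : ∀ M N, (∀ s, s ≠ s₀ → ∀ r, M r s = N r s) → H M = H N) :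
    ∑ M : ι → C → A, (∏ s, g s (fun r => M r s)) * H M = 0 := by
  have key := sum_mul_sum_eq_card_mul_sum (C := C) (A := ι → A) (fun c => c = s₀)
    (fun N => g s₀ (N s₀))
    (fun N => (∏ s ∈ univ.erase s₀, g s (N s)) * H (fun r s => N s r))
    (fun x y h => by rw [h s₀ rfl])
    (fun x y h => by
      congr 1
      · exact Finset.prod_congr rfl fun s hs => by rw [h s (Finset.ne_of_mem_erase hs)]
      · exact hH _ _ fun s hs r => by rw [h s hs])
  have h0 : ∑ N : C → ι → A, g s₀ (N s₀) = 0 := by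
    have := sum_prod_apply (A := ι → A) fun s a => if s = s₀ then g s a else 1
    rw [Finset.prod_eq_zero (Finset.mem_univ s₀) (by simpa using hg)] at this
    simpa [Finset.prod_ite_eq'] using this
  rw [h0, zero_mul, eq_comm, mul_eq_zero] at key
  have hcard : (Fintype.card (C → ι → A) : ℝ) ≠ 0 := by
    exact_mod_cast Fintype.card_ne_zero
  rw [← Equiv.sum_comp (Equiv.piComm fun (_ : C) (_ : ι) => A)]
  refine Eq.trans (Finset.sum_congr rfl fun N _ => ?_) (key.resolve_left hcard)
  rw [← mul_assoc, Finset.mul_prod_erase univ (fun s => g s (N s)) (Finset.mem_univ s₀)]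
  rfl

/-- A function constant on the classes of an equivalence relation is orthogonal to any function
whose class sums vanish. -/
lemma sum_mul_eq_zero_of_class_sums {Z : Type*} [Fintype Z] (r : Z → Z → Prop)
    (hr : Equivalence r) (f φ : Z → ℝ) (hf : ∀ z₀, ∑ z, (if r z z₀ then f z else 0) = 0)
    (hφ : ∀ z z', r z z' → φ z = φ z') : ∑ z, f z * φ z = 0 := by
  let S : Setoid Z := ⟨r, hr⟩
  rw [← Finset.sum_fiberwise univ (fun z => (Quotient.mk S z))]
  refine Finset.sum_eq_zero fun q _ => ?_
  induction q using Quotient.inductionOn with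
  | h z₀ =>
    have h1 : ∀ z, (Quotient.mk S z = Quotient.mk S z₀) ↔ r z z₀ := fun z => Quotient.eq (r := S)
    have := hf z₀
    rw [← Finset.sum_filter] at this
    simp only [h1]
    rw [Finset.sum_congr rfl fun z hz => by rw [hφ z z₀ (Finset.mem_filter.1 hz).2],
      ← Finset.sum_mul, this, zero_mul]

end FunctionSums

section Fourier

/-- The sign of a bit. -/
def bitSign (b : Bool) : ℝ := if b = true then -1 else 1

lemma chi_eq_prod {R : ℕ} (β : Finset (Fin R ⊕ Fin R)) (x : (Fin R ⊕ Fin R) → Bool) :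
    chi β x = ∏ s, if s ∈ β then bitSign (x s) else 1 := by
  rw [Finset.prod_ite_mem]
  simp [chi, bitSign]

lemma sum_chi_mul_chi {R : ℕ} (β β' : Finset (Fin R ⊕ Fin R)) :
    ∑ x, chi β x * chi β' x = if β = β' then (2 : ℝ) ^ (2 * R) else 0 := by
  simp only [chi_eq_prod, ← Finset.prod_mul_distrib]
  rw [sum_prod_apply fun s b =>
    (if s ∈ β then bitSign b else 1) * (if s ∈ β' then bitSign b else 1)]
  split_ifs with h
  · subst h
    rw [Finset.prod_congr rfl fun s _ => show _ = (2 : ℝ) by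
      by_cases hs : s ∈ β <;> norm_num [hs, bitSign]]
    simp [two_mul]
  · obtain ⟨s, hs⟩ : ∃ s, ¬ (s ∈ β ↔ s ∈ β') := by
      by_contra! hc
      exact h (Finset.ext hc)
    refine Finset.prod_eq_zero (Finset.mem_univ s) ?_
    by_cases h1 : s ∈ β <;> by_cases h2 : s ∈ β' <;> simp_all [bitSign]

lemma sum_chi_apply_mul {R : ℕ} (x y : (Fin R ⊕ Fin R) → Bool) :
    ∑ β, chi β x * chi β y = if x = y then (2 : ℝ) ^ (2 * R) else 0 := by
  have h : ∑ β, chi β x * chi β y = ∏ s, (1 + bitSign (x s) * bitSign (y s)) := by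
    rw [Finset.prod_one_add, Finset.powerset_univ]
    refine Finset.sum_congr rfl fun β _ => ?_
    rw [chi, chi, ← Finset.prod_mul_distrib]
    rfl
  rw [h]
  split_ifs with hxy
  · subst hxy
    rw [Finset.prod_congr rfl fun s _ => show _ = (2 : ℝ) by
      cases x s <;> simp [bitSign] <;> norm_num]
    simp [two_mul]
  · obtain ⟨s, hs⟩ := Function.ne_iff.1 hxy
    refine Finset.prod_eq_zero (Finset.mem_univ s) ?_
    cases h1 : x s <;> cases h2 : y s <;> simp_all [bitSign]

lemma sum_fhat_mul_chi {R : ℕ} (f : ((Fin R ⊕ Fin R) → Bool) → ℝ)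
    (y : (Fin R ⊕ Fin R) → Bool) : ∑ β, fhat f β * chi β y = f y := by
  simp only [fhat, div_mul_eq_mul_div, Finset.sum_mul]
  rw [← Finset.sum_div, Finset.sum_comm]
  simp only [mul_assoc, ← Finset.mul_sum, sum_chi_apply_mul]
  simp

lemma sub_noiseT_eq {R : ℕ} (γ : ℝ) (f : ((Fin R ⊕ Fin R) → Bool) → ℝ)
    (y : (Fin R ⊕ Fin R) → Bool) :
    f y - noiseT γ f y = ∑ β, (1 - (1 - γ) ^ β.card) * fhat f β * chi β y := by
  rw [noiseT]
  nth_rewrite 1 [← sum_fhat_mul_chi f y]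
  rw [← Finset.sum_sub_distrib]
  exact Finset.sum_congr rfl fun β _ => by ring

/-- Parseval's identity for a function given by a Fourier expansion. -/
lemma sum_sq_sum_chi {R : ℕ} (s : Finset (Finset (Fin R ⊕ Fin R)))
    (a : Finset (Fin R ⊕ Fin R) → ℝ) :
    ∑ x, (∑ β ∈ s, a β * chi β x) ^ 2 = (2 : ℝ) ^ (2 * R) * ∑ β ∈ s, a β ^ 2 := by
  have h : ∀ x, (∑ β ∈ s, a β * chi β x) ^ 2
      = ∑ β ∈ s, ∑ β' ∈ s, a β * a β' * (chi β x * chi β' x) := fun x => by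
    rw [sq, Finset.sum_mul_sum]
    exact Finset.sum_congr rfl fun _ _ => Finset.sum_congr rfl fun _ _ => by ring
  simp only [h]
  rw [Finset.sum_comm, Finset.mul_sum]
  refine Finset.sum_congr rfl fun β hβ => ?_
  rw [Finset.sum_comm]
  simp only [← Finset.mul_sum, sum_chi_mul_chi]
  simp [hβ]
  ring

end Fourier

section ColumnLaws

/-- Splitting off the last entry of a nonempty tuple. -/
lemma sum_extRow {A : Type} [Fintype A] {k : ℕ} (hk : 0 < k) (f : (Fin k → A) → ℝ) :
    ∑ a : Fin (k - 1) → A, ∑ b, f (extRow a b) = ∑ x, f x := by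
  obtain ⟨m, rfl⟩ : ∃ m, k = m + 1 := ⟨k - 1, by omega⟩
  have hext : ∀ (a : Fin m → A) (b : A), (extRow (k := m + 1) a b) = Fin.snoc a b := by
    intro a b
    funext j
    refine Fin.lastCases ?_ (fun i => ?_) j
    · simp [extRow]
    · simp [extRow, Fin.snoc_castSucc]
  rw [← (Fin.snocEquiv fun _ : Fin (m + 1) => A).sum_comp, Fintype.sum_prod_type,
    Finset.sum_comm]
  refine Finset.sum_congr rfl fun b _ => Finset.sum_congr rfl fun a _ => ?_
  exact congrArg f (hext a b)

/-- The last entry of `extRow a b` is `b`. -/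
lemma extRow_last {A : Type} {k : ℕ} (hk : 0 < k) (a : Fin (k - 1) → A) (b : A) :
    extRow a b ⟨k - 1, by omega⟩ = b := by
  simp [extRow]

lemma extRow_column {C A : Type} {k : ℕ} (Ym : Fin (k - 1) → C → A) (y : C → A) (s : C) :
    (fun r => extRow Ym y r s) = extRow (fun r => Ym r s) (y s) := by
  funext r
  unfold extRow
  split_ifs <;> rfl

/-- Probability distributions on `{0,1}^k` with uniform single-coordinate marginals. -/
structure IsUniformMarginal {k : ℕ} (P : (Fin k → Bool) → ℝ) : Prop where
  nonneg : ∀ x, 0 ≤ P x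
  sum_eq_one : ∑ x, P x = 1
  marginal : ∀ (j : Fin k) (b : Bool), ∑ x ∈ univ.filter (fun x : Fin k → Bool => x j = b), P x
    = 1 / 2

lemma IsUniformMarginal.sum_extRow_last {k : ℕ} (hk : 0 < k) {P : (Fin k → Bool) → ℝ}
    (hP : IsUniformMarginal P) (b : Bool) : ∑ a : Fin (k - 1) → Bool, P (extRow a b) = 1 / 2 := by
  rw [← hP.marginal ⟨k - 1, by omega⟩ b, Finset.sum_filter, ← sum_extRow hk]
  refine Finset.sum_congr rfl fun a _ => ?_
  simp [extRow_last hk]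

lemma isUniformMarginal_uniform {k : ℕ} :
    IsUniformMarginal (fun _ : Fin k → Bool => (1 : ℝ) / 2 ^ k) where
  nonneg x := by positivity
  sum_eq_one := by simp
  marginal j b := by
    have hflip : (univ.filter fun x : Fin k → Bool => x j = b).card
        = (univ.filter fun x : Fin k → Bool => ¬ x j = b).card := by
      refine Finset.card_bij' (fun x _ => Function.update x j (!x j))
        (fun x _ => Function.update x j (!x j)) ?_ ?_ ?_ ?_ <;>
        intro x <;> cases b <;> simp
    have hsum := Finset.card_filter_add_card_filter_not (s := univ)
      (fun x : Fin k → Bool => x j = b)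
    rw [← hflip] at hsum
    have h2 : ((univ.filter fun x : Fin k → Bool => x j = b).card : ℝ) * 2 = 2 ^ k := by
      have := congrArg (Nat.cast (R := ℝ)) hsum
      push_cast at this
      simp at this
      linarith
    rw [Finset.sum_const, nsmul_eq_mul]
    field_simp
    linarith

/-- The law of column `s` when the choices in its block are `p = (c₁, c₂)`: uniform if the half
containing `s` is resampled (`c₂ = some true` resamples the left half, `c₂ = some false` the right
half), and `pick P0 P1 c₁` otherwise. -/
noncomputable def columnLaw {k R : ℕ} (P0 P1 : (Fin k → Bool) → ℝ) (p : Bool × Option Bool)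
    (s : Fin R ⊕ Fin R) : (Fin k → Bool) → ℝ :=
  if p.2 = some s.isLeft then fun _ => 1 / 2 ^ k else pick P0 P1 p.1

/-- The choices governing the `Y`-columns, given those governing the `X`-columns. -/
def flipChoice (p : Bool × Option Bool) : Bool × Option Bool := (!p.1, p.2)

/-- The probability of the pair of choices `(c₁, c₂)` in a block. -/
noncomputable def choiceWeight (ε : ℝ) (p : Bool × Option Bool) : ℝ :=
  1 / 2 * if p.2 = none then 1 - 2 * ε else ε

lemma choiceWeight_nonneg {ε : ℝ} (hε1 : 0 < ε) (hε2 : ε ≤ 1 / 2) (p : Bool × Option Bool) :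
    0 ≤ choiceWeight ε p := by
  unfold choiceWeight
  split_ifs <;> linarith

lemma isUniformMarginal_columnLaw {k R : ℕ} {P0 P1 : (Fin k → Bool) → ℝ}
    (h0 : IsUniformMarginal P0) (h1 : IsUniformMarginal P1) (p : Bool × Option Bool)
    (s : Fin R ⊕ Fin R) : IsUniformMarginal (columnLaw P0 P1 p s) := by
  unfold columnLaw pick
  split_ifs
  · exact isUniformMarginal_uniform
  · exact h1
  · exact h0

lemma prod_blockOf {U V : Type} {L R : ℕ} (π : U → V → Fin R → Fin L) (u : U) (v : V) (i : Fin L)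
    (f : Fin R ⊕ Fin R → ℝ) :
    ∏ s ∈ univ.filter (fun s => blockOf π u v s = i), f s
      = (∏ j ∈ fib π u v i, f (Sum.inl j)) * ∏ j ∈ fib π u v i, f (Sum.inr j) := by
  rw [Finset.prod_filter, Fintype.prod_sum_type, fib, Finset.prod_filter, Finset.prod_filter]
  rfl

lemma mem_ptil_iff {U V : Type} {L R : ℕ} (π : U → V → Fin R → Fin L) (u : U) (w : V)
    (β : Finset (Fin R ⊕ Fin R)) (i : Fin L) :
    i ∈ ptil π u w β ↔ ∃ s ∈ β, blockOf π u w s = i := by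
  simp only [ptil, Finset.mem_filter, Finset.mem_univ, true_and]
  constructor
  · rintro ⟨j, hj | hj, h⟩
    · exact ⟨_, hj, h⟩
    · exact ⟨_, hj, h⟩
  · rintro ⟨s | s, hs, h⟩
    · exact ⟨s, Or.inl hs, h⟩
    · exact ⟨s, Or.inr hs, h⟩

variable {U V : Type} {k L R d : ℕ} {π : U → V → Fin R → Fin L} {ε : ℝ}
  {P0 P1 : (Fin k → Bool) → ℝ} {u : U} {v w : V}

/-- The block mass as a mixture of products of column laws. -/
lemma blockM_eq_sum (hfib : ∀ (u : U) (v : V) (i : Fin L), (fib π u v i).card = d) (i : Fin L)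
    (X Y : Fin k → (Fin R ⊕ Fin R) → Bool) :
    blockM π ε P0 P1 d u v w i X Y = ∑ p : Bool × Option Bool, choiceWeight ε p *
      ((∏ s ∈ univ.filter (fun s => blockOf π u v s = i), columnLaw P0 P1 p s fun r => X r s) *
      ∏ s ∈ univ.filter (fun s => blockOf π u w s = i),
        columnLaw P0 P1 (flipChoice p) s fun r => Y r s) := by
  simp only [blockM, prod_blockOf, Fintype.sum_prod_type, Fintype.sum_option, Fintype.sum_bool,
    columnLaw, flipChoice, choiceWeight, Sum.isLeft_inl, Sum.isLeft_inr, Finset.prod_mul_distrib]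
  simp [hfib]
  ring

lemma blockM_nonneg (hfib : ∀ (u : U) (v : V) (i : Fin L), (fib π u v i).card = d)
    (hε1 : 0 < ε) (hε2 : ε ≤ 1 / 2)
    (h0 : IsUniformMarginal P0) (h1 : IsUniformMarginal P1) (i : Fin L)
    (X Y : Fin k → (Fin R ⊕ Fin R) → Bool) : 0 ≤ blockM π ε P0 P1 d u v w i X Y := by
  rw [blockM_eq_sum hfib]
  exact Finset.sum_nonneg fun p _ => mul_nonneg (choiceWeight_nonneg hε1 hε2 p) <| mul_nonneg
    (Finset.prod_nonneg fun s _ => (isUniformMarginal_columnLaw h0 h1 p s).nonneg _)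
    (Finset.prod_nonneg fun s _ => (isUniformMarginal_columnLaw h0 h1 _ s).nonneg _)

/-- The block mass only depends on the columns in the block. -/
lemma blockM_congr (hfib : ∀ (u : U) (v : V) (i : Fin L), (fib π u v i).card = d) (i : Fin L)
    {X Y X' Y' : Fin k → (Fin R ⊕ Fin R) → Bool}
    (hX : ∀ s, blockOf π u v s = i → ∀ r, X r s = X' r s)
    (hY : ∀ s, blockOf π u w s = i → ∀ r, Y r s = Y' r s) :
    blockM π ε P0 P1 d u v w i X Y = blockM π ε P0 P1 d u v w i X' Y' := by
  rw [blockM_eq_sum hfib, blockM_eq_sum hfib]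
  refine Finset.sum_congr rfl fun p _ => ?_
  congr 2 <;> refine Finset.prod_congr rfl fun s hs => ?_
  · simp only [hX s (Finset.mem_filter.1 hs).2]
  · simp only [hY s (Finset.mem_filter.1 hs).2]

variable (π ε P0 P1 u v w) in
/-- The part of the mass of the test `𝒯₂` coming from the choices `c` in the blocks. -/
noncomputable def choiceMass (c : Fin L → Bool × Option Bool)
    (X Y : Fin k → (Fin R ⊕ Fin R) → Bool) : ℝ :=
  (∏ i, choiceWeight ε (c i)) *
    ((∏ s, columnLaw P0 P1 (c (blockOf π u v s)) s fun r => X r s) *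
      ∏ s, columnLaw P0 P1 (flipChoice (c (blockOf π u w s))) s fun r => Y r s)

/-- The mass of the test `𝒯₂` is a mixture of products of column laws. -/
lemma massT2_eq_sum (hfib : ∀ (u : U) (v : V) (i : Fin L), (fib π u v i).card = d)
    (X Y : Fin k → (Fin R ⊕ Fin R) → Bool) :
    massT2 π ε P0 P1 d u v w X Y = ∑ c, choiceMass π ε P0 P1 u v w c X Y := by
  simp only [massT2, blockM_eq_sum hfib]
  rw [Finset.prod_univ_sum, Fintype.piFinset_univ]
  refine Finset.sum_congr rfl fun c _ => ?_
  rw [choiceMass, Finset.prod_mul_distrib, Finset.prod_mul_distrib,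
    ← Finset.prod_fiberwise univ (blockOf π u v), ← Finset.prod_fiberwise univ (blockOf π u w)]
  congr 2 <;> refine Finset.prod_congr rfl fun i _ => Finset.prod_congr rfl fun s hs => ?_ <;>
    rw [(Finset.mem_filter.1 hs).2]

lemma choiceMass_nonneg (hε1 : 0 < ε) (hε2 : ε ≤ 1 / 2)
    (h0 : IsUniformMarginal P0) (h1 : IsUniformMarginal P1) (c : Fin L → Bool × Option Bool)
    (X Y : Fin k → (Fin R ⊕ Fin R) → Bool) : 0 ≤ choiceMass π ε P0 P1 u v w c X Y :=
  mul_nonneg (Finset.prod_nonneg fun _ _ => choiceWeight_nonneg hε1 hε2 _) <| mul_nonneg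
    (Finset.prod_nonneg fun s _ => (isUniformMarginal_columnLaw h0 h1 _ s).nonneg _)
    (Finset.prod_nonneg fun s _ => (isUniformMarginal_columnLaw h0 h1 _ s).nonneg _)

/-- For fixed choices the last row is uniformly distributed. -/
lemma sum_choiceMass_extRow (hk : 0 < k)
    (h0 : IsUniformMarginal P0) (h1 : IsUniformMarginal P1) (c : Fin L → Bool × Option Bool)
    (y : (Fin R ⊕ Fin R) → Bool) :
    ∑ z : (Fin k → (Fin R ⊕ Fin R) → Bool) × (Fin (k - 1) → (Fin R ⊕ Fin R) → Bool),
      choiceMass π ε P0 P1 u v w c z.1 (extRow z.2 y)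
      = (∏ i, choiceWeight ε (c i)) / 2 ^ (2 * R) := by
  simp only [choiceMass, extRow_column]
  rw [Fintype.sum_prod_type]
  simp only [← Finset.mul_sum]
  rw [← Finset.sum_mul, sum_prod_columns fun s =>
      columnLaw P0 P1 (c (blockOf π u v s)) s, sum_prod_columns fun s (a : Fin (k - 1) → Bool) =>
      columnLaw P0 P1 (flipChoice (c (blockOf π u w s))) s (extRow a (y s))]
  simp only [(isUniformMarginal_columnLaw h0 h1 _ _).sum_eq_one,
    (isUniformMarginal_columnLaw h0 h1 _ _).sum_extRow_last hk]
  simp [two_mul, div_eq_mul_inv]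

/-- For fixed choices the conditional mean of a character factors over the columns. -/
lemma sum_choiceMass_mul_chi (c : Fin L → Bool × Option Bool) (β : Finset (Fin R ⊕ Fin R))
    (X : Fin k → (Fin R ⊕ Fin R) → Bool) (Ym : Fin (k - 1) → (Fin R ⊕ Fin R) → Bool) :
    ∑ y, choiceMass π ε P0 P1 u v w c X (extRow Ym y) * chi β y
      = (∏ i, choiceWeight ε (c i)) *
        (∏ s, columnLaw P0 P1 (c (blockOf π u v s)) s fun r => X r s) *
        ∏ s, ∑ b, columnLaw P0 P1 (flipChoice (c (blockOf π u w s))) s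
          (extRow (fun r => Ym r s) b) * if s ∈ β then bitSign b else 1 := by
  rw [← sum_prod_apply fun s b => columnLaw P0 P1 (flipChoice (c (blockOf π u w s))) s
          (extRow (fun r => Ym r s) b) * if s ∈ β then bitSign b else 1, Finset.mul_sum]
  refine Finset.sum_congr rfl fun y _ => ?_
  rw [Finset.prod_mul_distrib, ← chi_eq_prod, choiceMass]
  simp only [extRow_column]
  ring

/-- A character involving a resampled coordinate has conditional mean zero. -/
lemma sum_choiceMass_mul_chi_eq_zero (c : Fin L → Bool × Option Bool)
    {β : Finset (Fin R ⊕ Fin R)} {s : Fin R ⊕ Fin R} (hs : s ∈ β)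
    (hc : (c (blockOf π u w s)).2 = some s.isLeft)
    (X : Fin k → (Fin R ⊕ Fin R) → Bool) (Ym : Fin (k - 1) → (Fin R ⊕ Fin R) → Bool) :
    ∑ y, choiceMass π ε P0 P1 u v w c X (extRow Ym y) * chi β y = 0 := by
  rw [sum_choiceMass_mul_chi]
  refine mul_eq_zero_of_right _ (Finset.prod_eq_zero (Finset.mem_univ s) ?_)
  simp [columnLaw, flipChoice, hc, hs, bitSign]

/-- A character involving a coordinate ignored by `H` is orthogonal to `H`. -/
lemma sum_massT2_mul_chi_mul_eq_zero
    (hfib : ∀ (u : U) (v : V) (i : Fin L), (fib π u v i).card = d) (hk : 0 < k)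
    (h0 : IsUniformMarginal P0) (h1 : IsUniformMarginal P1)
    {β : Finset (Fin R ⊕ Fin R)} {s : Fin R ⊕ Fin R} (hs : s ∈ β)
    (H : (Fin k → (Fin R ⊕ Fin R) → Bool) × (Fin (k - 1) → (Fin R ⊕ Fin R) → Bool) → ℝ)
    (hH : ∀ X M N, (∀ s', s' ≠ s → ∀ r, M r s' = N r s') → H (X, M) = H (X, N)) :
    ∑ z, (∑ y, massT2 π ε P0 P1 d u v w z.1 (extRow z.2 y) * chi β y) * H z = 0 := by
  have hmass : ∀ X M, ∑ y, massT2 π ε P0 P1 d u v w X (extRow M y) * chi β y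
      = ∑ c, ∑ y, choiceMass π ε P0 P1 u v w c X (extRow M y) * chi β y := fun X M => by
    rw [Finset.sum_comm]
    simp only [massT2_eq_sum hfib, Finset.sum_mul]
  simp only [hmass, sum_choiceMass_mul_chi]
  simp only [Finset.sum_mul]
  rw [Finset.sum_comm]
  refine Finset.sum_eq_zero fun c _ => ?_
  rw [Fintype.sum_prod_type]
  refine Finset.sum_eq_zero fun X _ => ?_
  simp only [mul_assoc]
  simp only [← Finset.mul_sum]
  rw [sum_prod_columns_mul_eq_zero (fun s (a : Fin (k - 1) → Bool) =>
    ∑ b, columnLaw P0 P1 (flipChoice (c (blockOf π u w s))) s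
          (extRow a b) * if s ∈ β then bitSign b else 1) (fun Ym => H (X, Ym)) s ?_ (hH X)]
  · simp
  · rw [Finset.sum_comm]
    simp only [← Finset.sum_mul,
      (isUniformMarginal_columnLaw h0 h1 _ _).sum_extRow_last hk]
    simp [hs, bitSign]

end ColumnLaws

section EfronStein

variable {U V : Type} {k L R d : ℕ} {π : U → V → Fin R → Fin L} {ε : ℝ}
  {P0 P1 : (Fin k → Bool) → ℝ} {u : U} {v w : V}

lemma agreeBlocks_equivalence (α : Finset (Fin L)) :
    Equivalence (agreeBlocks (k := k) π u v w α) where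
  refl _ := ⟨fun _ _ _ => rfl, fun _ _ _ => rfl⟩
  symm h := ⟨fun c hc r => (h.1 c hc r).symm, fun c hc r => (h.2 c hc r).symm⟩
  trans h h' := ⟨fun c hc r => (h.1 c hc r).trans (h'.1 c hc r),
    fun c hc r => (h.2 c hc r).trans (h'.2 c hc r)⟩

lemma extRow_congr {C A : Type} {M N : Fin (k - 1) → C → A} {x y : C → A} {s : C}
    (hM : ∀ r, M r s = N r s) (hx : x s = y s) (r : Fin k) :
    extRow M x r s = extRow N y r s := by
  unfold extRow
  split_ifs
  · exact hM _
  · exact hx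

lemma massT2_nonneg (hfib : ∀ (u : U) (v : V) (i : Fin L), (fib π u v i).card = d)
    (hε1 : 0 < ε) (hε2 : ε ≤ 1 / 2) (h0 : IsUniformMarginal P0) (h1 : IsUniformMarginal P1)
    (X Y : Fin k → (Fin R ⊕ Fin R) → Bool) : 0 ≤ massT2 π ε P0 P1 d u v w X Y :=
  Finset.prod_nonneg fun i _ => blockM_nonneg hfib hε1 hε2 h0 h1 i X Y

/-- The conditional mean of a character depends only on the blocks it touches. -/
lemma exists_condExp_chi (hfib : ∀ (u : U) (v : V) (i : Fin L), (fib π u v i).card = d)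
    (hε1 : 0 < ε) (hε2 : ε ≤ 1 / 2) (h0 : IsUniformMarginal P0) (h1 : IsUniformMarginal P1)
    (β : Finset (Fin R ⊕ Fin R)) :
    ∃ φ : (Fin k → (Fin R ⊕ Fin R) → Bool) × (Fin (k - 1) → (Fin R ⊕ Fin R) → Bool) → ℝ,
      (∀ z z', agreeBlocks π u v w (ptil π u w β) z z' → φ z = φ z') ∧
      ∀ z, ∑ y, massT2 π ε P0 P1 d u v w z.1 (extRow z.2 y) * chi β y
        = margT2 π ε P0 P1 d u v w z * φ z := by
  set B := ptil π u w β with hB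
  let Z := (Fin k → (Fin R ⊕ Fin R) → Bool) × (Fin (k - 1) → (Fin R ⊕ Fin R) → Bool)
  let inner : Z → ((Fin R ⊕ Fin R) → Bool) → ℝ := fun z y =>
    ∏ i ∈ B, blockM π ε P0 P1 d u v w i z.1 (extRow z.2 y)
  let outer : Z → ((Fin R ⊕ Fin R) → Bool) → ℝ := fun z y =>
    ∏ i ∈ Bᶜ, blockM π ε P0 P1 d u v w i z.1 (extRow z.2 y)
  have hmass : ∀ z y, massT2 π ε P0 P1 d u v w z.1 (extRow z.2 y) = inner z y * outer z y :=
    fun z y => (Finset.prod_mul_prod_compl B _).symm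
  have hinner0 : ∀ z y, 0 ≤ inner z y := fun z y =>
    Finset.prod_nonneg fun i _ => blockM_nonneg hfib hε1 hε2 h0 h1 i _ _
  have hinner : ∀ (z z' : Z) y y', agreeBlocks π u v w B z z' →
      (∀ s, blockOf π u w s ∈ B → y s = y' s) → inner z y = inner z' y' := fun z z' y y' hz hy =>
    Finset.prod_congr rfl fun i hi => blockM_congr hfib i
      (fun s hs r => hz.1 s (hs ▸ hi) r)
      (fun s hs r => extRow_congr (hz.2 s (hs ▸ hi)) (hy s (hs ▸ hi)) r)
  have houter : ∀ (z : Z) y y', (∀ s, blockOf π u w s ∉ B → y s = y' s) →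
      outer z y = outer z y' := fun z y y' hy =>
    Finset.prod_congr rfl fun i hi => blockM_congr hfib i (fun s hs r => rfl)
      (fun s hs r => extRow_congr (fun _ => rfl)
        (hy s (hs ▸ Finset.mem_compl.1 hi)) r)
  have hchi : ∀ y y', (∀ s, blockOf π u w s ∈ B → y s = y' s) → chi β y = chi β y' :=
    fun y y' hy => Finset.prod_congr rfl fun s hs => by
      rw [hy s (hB ▸ (mem_ptil_iff π u w β _).2 ⟨s, hs, rfl⟩)]
  refine ⟨fun z => (∑ y, inner z y * chi β y) / ∑ y, inner z y, fun z z' hz => ?_, fun z => ?_⟩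
  · have h : ∀ y, inner z y = inner z' y := fun y => hinner z z' y y hz fun _ _ => rfl
    simp only [h]
  · have hcard : (Fintype.card ((Fin R ⊕ Fin R) → Bool) : ℝ) ≠ 0 := by
      exact_mod_cast Fintype.card_ne_zero
    have hrefl := (agreeBlocks_equivalence (k := k) (π := π) (u := u) (v := v) (w := w) B).refl z
    have e1 := sum_mul_sum_eq_card_mul_sum (fun s => blockOf π u w s ∈ B)
      (fun y => inner z y * chi β y) (outer z)
      (fun y y' h => by rw [hinner z z y y' hrefl h, hchi y y' h]) (houter z)
    have e2 := sum_mul_sum_eq_card_mul_sum (fun s => blockOf π u w s ∈ B)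
      (inner z) (outer z) (fun y y' h => hinner z z y y' hrefl h) (houter z)
    have e3 : ∑ y, inner z y * chi β y
        = (∑ y, inner z y) * ((∑ y, inner z y * chi β y) / ∑ y, inner z y) := by
      by_cases hz : ∑ y, inner z y = 0
      · have h : ∀ y, inner z y = 0 := fun y =>
          (Finset.sum_eq_zero_iff_of_nonneg fun y _ => hinner0 z y).1 hz y (Finset.mem_univ y)
        simp [h]
      · rw [mul_div_cancel₀ _ hz]
    simp only [margT2, hmass]
    apply mul_left_cancel₀ hcard
    rw [← mul_assoc, ← e2, mul_right_comm, ← e3, e1]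
    exact congrArg _ (Finset.sum_congr rfl fun y _ => by ring)

lemma margT2_mul_markovT2 (hfib : ∀ (u : U) (v : V) (i : Fin L), (fib π u v i).card = d)
    (hε1 : 0 < ε) (hε2 : ε ≤ 1 / 2) (h0 : IsUniformMarginal P0) (h1 : IsUniformMarginal P1)
    (g : ((Fin R ⊕ Fin R) → Bool) → ℝ)
    (z : (Fin k → (Fin R ⊕ Fin R) → Bool) × (Fin (k - 1) → (Fin R ⊕ Fin R) → Bool)) :
    margT2 π ε P0 P1 d u v w z * markovT2 π ε P0 P1 d u v w g z
      = ∑ y, massT2 π ε P0 P1 d u v w z.1 (extRow z.2 y) * g y := by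
  by_cases hz : margT2 π ε P0 P1 d u v w z = 0
  · have h := (Finset.sum_eq_zero_iff_of_nonneg fun y _ =>
      massT2_nonneg hfib hε1 hε2 h0 h1 z.1 (extRow z.2 y)).1 hz
    rw [hz, zero_mul, eq_comm]
    exact Finset.sum_eq_zero fun y hy => by rw [h y hy, zero_mul]
  · rw [markovT2, mul_div_cancel₀ _ hz]

variable (π u w) in
/-- The choices `c` resample no coordinate of `β` in the last row. -/
def AvoidsResampling (c : Fin L → Bool × Option Bool) (β : Finset (Fin R ⊕ Fin R)) : Prop :=
  ∀ s ∈ β, (c (blockOf π u w s)).2 ≠ some s.isLeft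

/-- A character survives the resampling with probability at most `1 - ε` in each block. -/
lemma sum_choiceWeight_avoids_le (hε1 : 0 < ε) (hε2 : ε ≤ 1 / 2)
    (β : Finset (Fin R ⊕ Fin R)) :
    ∑ c : Fin L → Bool × Option Bool,
      (if AvoidsResampling π u w c β then ∏ i, choiceWeight ε (c i) else 0)
      ≤ (1 - ε) ^ (ptil π u w β).card := by
  let ok : Fin L → Bool × Option Bool → Prop := fun i p =>
    ∀ s ∈ β, blockOf π u w s = i → p.2 ≠ some s.isLeft
  have hterm : ∀ c : Fin L → Bool × Option Bool,
      (if AvoidsResampling π u w c β then ∏ i, choiceWeight ε (c i) else 0)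
        = ∏ i, if ok i (c i) then choiceWeight ε (c i) else 0 := fun c => by
    split_ifs with h
    · refine Finset.prod_congr rfl fun i _ => (if_pos ?_).symm
      rintro s hs rfl
      exact h s hs
    · obtain ⟨s, hs, hc⟩ : ∃ s ∈ β, (c (blockOf π u w s)).2 = some s.isLeft := by
        simpa only [AvoidsResampling, not_forall, not_not, exists_prop] using h
      exact (Finset.prod_eq_zero (Finset.mem_univ (blockOf π u w s))
        (if_neg fun h' => h' s hs rfl hc)).symm
  simp only [hterm]
  rw [sum_prod_apply fun i p => if ok i p then choiceWeight ε p else 0]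
  have htotal : ∑ p, choiceWeight ε p = 1 := by
    simp [Fintype.sum_prod_type, Fintype.sum_option, choiceWeight]
  calc ∏ i, ∑ p, (if ok i p then choiceWeight ε p else 0)
      ≤ ∏ i, if i ∈ ptil π u w β then 1 - ε else 1 := by
        refine Finset.prod_le_prod (fun i _ => Finset.sum_nonneg fun p _ => ?_) fun i _ => ?_
        · split_ifs
          exacts [choiceWeight_nonneg hε1 hε2 p, le_rfl]
        split_ifs with hi
        · obtain ⟨s, hs, hsi⟩ := (mem_ptil_iff π u w β i).1 hi
          calc ∑ p, (if ok i p then choiceWeight ε p else 0)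
              ≤ ∑ p : Bool × Option Bool,
                  if p.2 ≠ some s.isLeft then choiceWeight ε p else 0 := by
                refine Finset.sum_le_sum fun p _ => ?_
                by_cases hp : ok i p
                · rw [if_pos hp, if_pos (hp s hs hsi)]
                · rw [if_neg hp]
                  split_ifs
                  exacts [choiceWeight_nonneg hε1 hε2 p, le_rfl]
            _ = 1 - ε := by
                cases s <;>
                  simp [Fintype.sum_prod_type, Fintype.sum_option, choiceWeight] <;> ring
        · rw [← htotal]
          refine Finset.sum_le_sum fun p _ => ?_
          split_ifs
          exacts [le_rfl, choiceWeight_nonneg hε1 hε2 p]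
    _ = (1 - ε) ^ (ptil π u w β).card := by
        rw [Finset.prod_ite_mem]
        simp

/-- The correlation of a function of `(X, Y_{-k})` with a Fourier expansion in `y_k` is controlled
by the part of the expansion that survives the resampling. -/
lemma sq_sum_massT2_mul_le (hfib : ∀ (u : U) (v : V) (i : Fin L), (fib π u v i).card = d)
    (hk : 0 < k) (hε1 : 0 < ε) (hε2 : ε ≤ 1 / 2)
    (h0 : IsUniformMarginal P0) (h1 : IsUniformMarginal P1)
    (F : (Fin k → (Fin R ⊕ Fin R) → Bool) × (Fin (k - 1) → (Fin R ⊕ Fin R) → Bool) → ℝ)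
    (S : Finset (Finset (Fin R ⊕ Fin R))) (a : Finset (Fin R ⊕ Fin R) → ℝ) :
    (∑ z, F z * ∑ y, massT2 π ε P0 P1 d u v w z.1 (extRow z.2 y) * ∑ β ∈ S, a β * chi β y) ^ 2
      ≤ (∑ z, margT2 π ε P0 P1 d u v w z * F z ^ 2) *
        ∑ β ∈ S, (1 - ε) ^ (ptil π u w β).card * a β ^ 2 := by
  let Z := (Fin k → (Fin R ⊕ Fin R) → Bool) × (Fin (k - 1) → (Fin R ⊕ Fin R) → Bool)
  let W : (Fin L → Bool × Option Bool) → Z → ((Fin R ⊕ Fin R) → Bool) → ℝ := fun c z y =>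
    choiceMass π ε P0 P1 u v w c z.1 (extRow z.2 y)
  let h : (Fin L → Bool × Option Bool) → ((Fin R ⊕ Fin R) → Bool) → ℝ := fun c y =>
    ∑ β ∈ S.filter (AvoidsResampling π u w c), a β * chi β y
  have hmass : ∀ (z : Z) y, massT2 π ε P0 P1 d u v w z.1 (extRow z.2 y) = ∑ c, W c z y :=
    fun z y => massT2_eq_sum hfib _ _
  have hW : ∀ c z y, 0 ≤ W c z y := fun c z y => choiceMass_nonneg hε1 hε2 h0 h1 c _ _
  have hsurvive : ∀ c z, ∑ y, W c z y * ∑ β ∈ S, a β * chi β y = ∑ y, W c z y * h c y := by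
    intro c z
    simp only [h, Finset.mul_sum]
    rw [Finset.sum_comm, Finset.sum_comm (s := univ), Finset.sum_filter]
    refine Finset.sum_congr rfl fun β _ => ?_
    split_ifs with hβ
    · rfl
    · obtain ⟨s, hs, hc⟩ : ∃ s ∈ β, (c (blockOf π u w s)).2 = some s.isLeft := by
        simpa only [AvoidsResampling, not_forall, not_not, exists_prop] using hβ
      simp only [mul_left_comm _ (a β)]
      rw [← Finset.mul_sum, sum_choiceMass_mul_chi_eq_zero c hs hc, mul_zero]
  have hcorr : ∑ z, F z * ∑ y, massT2 π ε P0 P1 d u v w z.1 (extRow z.2 y) *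
      ∑ β ∈ S, a β * chi β y
      = ∑ t : (Fin L → Bool × Option Bool) × Z × ((Fin R ⊕ Fin R) → Bool),
        W t.1 t.2.1 t.2.2 * (F t.2.1 * h t.1 t.2.2) := by
    conv_rhs => rw [Fintype.sum_prod_type]
    conv_rhs => enter [2, c]; rw [Fintype.sum_prod_type]
    rw [Finset.sum_comm]
    refine Finset.sum_congr rfl fun z _ => ?_
    simp only [hmass, Finset.sum_mul (s := (univ : Finset (Fin L → Bool × Option Bool)))]
    rw [Finset.sum_comm, Finset.mul_sum]
    refine Finset.sum_congr rfl fun c _ => ?_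
    rw [hsurvive, Finset.mul_sum]
    exact Finset.sum_congr rfl fun y _ => by ring
  have hFsq : ∑ t : (Fin L → Bool × Option Bool) × Z × ((Fin R ⊕ Fin R) → Bool),
      W t.1 t.2.1 t.2.2 * F t.2.1 ^ 2 = ∑ z, margT2 π ε P0 P1 d u v w z * F z ^ 2 := by
    rw [Fintype.sum_prod_type]
    simp only [Fintype.sum_prod_type (α₁ := Z)]
    rw [Finset.sum_comm]
    refine Finset.sum_congr rfl fun z _ => ?_
    rw [margT2, Finset.sum_comm, Finset.sum_mul]
    refine Finset.sum_congr rfl fun y _ => ?_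
    rw [hmass, Finset.sum_mul]
  have hhsq : ∑ t : (Fin L → Bool × Option Bool) × Z × ((Fin R ⊕ Fin R) → Bool),
      W t.1 t.2.1 t.2.2 * h t.1 t.2.2 ^ 2
      ≤ ∑ β ∈ S, (1 - ε) ^ (ptil π u w β).card * a β ^ 2 := by
    calc _ = ∑ c : Fin L → Bool × Option Bool, (∏ i, choiceWeight ε (c i)) *
          ∑ β ∈ S.filter (AvoidsResampling π u w c), a β ^ 2 := by
          rw [Fintype.sum_prod_type]
          refine Finset.sum_congr rfl fun c _ => ?_
          rw [Fintype.sum_prod_type, Finset.sum_comm]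
          simp only [← Finset.sum_mul]
          have hz : ∀ y, ∑ z, W c z y = (∏ i, choiceWeight ε (c i)) / 2 ^ (2 * R) :=
            fun y => sum_choiceMass_extRow hk h0 h1 c y
          simp only [hz]
          rw [← Finset.mul_sum, sum_sq_sum_chi]
          field_simp
      _ = ∑ β ∈ S, (∑ c : Fin L → Bool × Option Bool,
            if AvoidsResampling π u w c β then ∏ i, choiceWeight ε (c i) else 0) * a β ^ 2 := by
          simp only [Finset.sum_filter, Finset.mul_sum, Finset.sum_mul]
          rw [Finset.sum_comm]
          refine Finset.sum_congr rfl fun β _ => Finset.sum_congr rfl fun c _ => ?_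
          split_ifs <;> simp
      _ ≤ _ := Finset.sum_le_sum fun β _ =>
          mul_le_mul_of_nonneg_right (sum_choiceWeight_avoids_le hε1 hε2 β) (sq_nonneg _)
  rw [hcorr]
  refine (Finset.sum_sq_le_sum_mul_sum_of_sq_le_mul univ
    (f := fun t => W t.1 t.2.1 t.2.2 * F t.2.1 ^ 2)
    (g := fun t => W t.1 t.2.1 t.2.2 * h t.1 t.2.2 ^ 2)
    (fun t _ => mul_nonneg (hW _ _ _) (sq_nonneg _))
    (fun t _ => mul_nonneg (hW _ _ _) (sq_nonneg _)) fun t _ => le_of_eq (by ring)).trans ?_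
  rw [hFsq]
  refine mul_le_mul_of_nonneg_left hhsq (Finset.sum_nonneg fun z _ => mul_nonneg ?_ (sq_nonneg _))
  exact Finset.sum_nonneg fun y _ => massT2_nonneg hfib hε1 hε2 h0 h1 _ _

end EfronStein

/-- in the setting of `𝒯₂` with `u, v, w` fixed, let
`G = U((I − T_{1-γ}) f_w)` and let `G = Σ_α G_α` be its Efron–Stein decomposition with
respect to the marginal of `𝒯₂` on `(X, Y_{-k})` and the block structure indexed by
`i ∈ [L]`.  Then for every `α ⊆ [L]`,
`‖G_α‖₂² ≤ (1−ε)^{|α|} Σ_{β : π̃_{uw}(β) = α} (1 − (1−γ)^{2|β|}) f̂_w(β)²`. -/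
theorem stmt_10 (k L R d : ℕ) (hk : 2 ≤ k) (hd : 0 < d) (hR : R = d * L)
    {U V : Type} [Fintype U] [Fintype V] [Nonempty U] [Nonempty V]
    (Adj : U → V → Bool) (π : U → V → Fin R → Fin L)
    (dU dV : ℕ) (hdU : 0 < dU) (hdV : 0 < dV)
    (hregU : ∀ u : U, (nbr Adj u).card = dU)
    (hregV : ∀ v : V, (univ.filter (fun u : U => Adj u v = true)).card = dV)
    (hfib : ∀ (u : U) (v : V) (i : Fin L), (fib π u v i).card = d)
    (ε : ℝ) (hε1 : 0 < ε) (hε2 : ε ≤ 1 / 2)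
    (P0 P1 : (Fin k → Bool) → ℝ)
    (hP0 : ∀ x, 0 ≤ P0 x) (hP1 : ∀ x, 0 ≤ P1 x)
    (hP0s : ∑ x, P0 x = 1) (hP1s : ∑ x, P1 x = 1)
    (hP0m : ∀ (j : Fin k) (b : Bool),
      ∑ x ∈ univ.filter (fun x : Fin k → Bool => x j = b), P0 x = 1 / 2)
    (hP1m : ∀ (j : Fin k) (b : Bool),
      ∑ x ∈ univ.filter (fun x : Fin k → Bool => x j = b), P1 x = 1 / 2)
    (hP0p : ∀ x : Fin k → Bool, P0 x ≠ 0 → Even (univ.filter (fun i => x i = true)).card)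
    (hP1p : ∀ x : Fin k → Bool, P1 x ≠ 0 → Odd (univ.filter (fun i => x i = true)).card)
    (u : U) (v w : V) (hAuv : Adj u v = true) (hAuw : Adj u w = true)
    (γ : ℝ) (hγ1 : 0 < γ) (hγ2 : γ < 1)
    (fw : ((Fin R ⊕ Fin R) → Bool) → ℝ) (hfw : ∀ x, fw x = 1 ∨ fw x = -1)
    (Gd : Finset (Fin L) →
      ((Fin k → (Fin R ⊕ Fin R) → Bool) × (Fin (k - 1) → (Fin R ⊕ Fin R) → Bool)) → ℝ)
    (hGsum : ∀ z, ∑ α : Finset (Fin L), Gd α z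
      = markovT2 π ε P0 P1 d u v w (fun y => fw y - noiseT γ fw y) z)
    (hGdep : ∀ (α : Finset (Fin L)) z z', agreeBlocks π u v w α z z' → Gd α z = Gd α z')
    (hGcond : ∀ (α β' : Finset (Fin L)), ¬ α ⊆ β' → ∀ z₀,
      (∑ z, margT2 π ε P0 P1 d u v w z *
        (if agreeBlocks π u v w β' z z₀ then Gd α z else 0)) = 0) :
    ∀ α : Finset (Fin L),
      (∑ z, margT2 π ε P0 P1 d u v w z * (Gd α z) ^ 2)
        ≤ (1 - ε) ^ α.card *
          ∑ β ∈ univ.filter (fun β : Finset (Fin R ⊕ Fin R) => ptil π u w β = α),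
            (1 - (1 - γ) ^ (2 * β.card)) * (fhat fw β) ^ 2 := by
  have hk0 : 0 < k := by omega
  have h0 : IsUniformMarginal P0 := ⟨hP0, hP0s, fun j b => by convert hP0m j b⟩
  have h1 : IsUniformMarginal P1 := ⟨hP1, hP1s, fun j b => by convert hP1m j b⟩
  intro α
  set a : Finset (Fin R ⊕ Fin R) → ℝ := fun β => (1 - (1 - γ) ^ β.card) * fhat fw β with ha
  set S : Finset (Finset (Fin R ⊕ Fin R)) := univ.filter fun β => ptil π u w β = α with hS
  have hclass : ∀ (α' B : Finset (Fin L)), ¬ α' ⊆ B →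
      ∀ φ : (Fin k → (Fin R ⊕ Fin R) → Bool) × (Fin (k - 1) → (Fin R ⊕ Fin R) → Bool) → ℝ,
      (∀ z z', agreeBlocks π u v w B z z' → φ z = φ z') →
      ∑ z, margT2 π ε P0 P1 d u v w z * Gd α' z * φ z = 0 := fun α' B hB φ hφ =>
    sum_mul_eq_zero_of_class_sums _ (agreeBlocks_equivalence B) _ φ
      (fun z₀ => by simpa only [mul_ite, mul_zero] using hGcond α' B hB z₀) hφ
  have hortho : ∀ α', α' ≠ α → ∑ z, margT2 π ε P0 P1 d u v w z * Gd α z * Gd α' z = 0 := by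
    intro α' hα'
    by_cases hsub : α ⊆ α'
    · have h := hclass α' α (fun h => hα' (Finset.Subset.antisymm h hsub)) _ (hGdep α)
      simpa only [mul_right_comm] using h
    · exact hclass α α' hsub _ (hGdep α')
  have hchar : ∀ β, β ∉ S →
      ∑ z, Gd α z * ∑ y, massT2 π ε P0 P1 d u v w z.1 (extRow z.2 y) * chi β y = 0 := by
    intro β hβ
    replace hβ : ptil π u w β ≠ α := by simpa [hS] using hβ
    by_cases hsub : α ⊆ ptil π u w β
    · obtain ⟨i, hi, hiα⟩ := Finset.exists_of_ssubset (hsub.ssubset_of_ne hβ.symm)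
      obtain ⟨s, hs, rfl⟩ := (mem_ptil_iff π u w β i).1 hi
      simp only [mul_comm (Gd α _)]
      refine sum_massT2_mul_chi_mul_eq_zero hfib hk0 h0 h1 hs (Gd α) fun X M N hMN => ?_
      refine hGdep α _ _ ⟨fun _ _ _ => rfl, fun c hc r => hMN c ?_ r⟩
      rintro rfl
      exact hiα hc
    · obtain ⟨φ, hφ, hsum⟩ := exists_condExp_chi (v := v) (w := w) (u := u) hfib hε1 hε2 h0 h1 β
      simp only [hsum]
      rw [← hclass α _ hsub φ hφ]
      exact Finset.sum_congr rfl fun z _ => by ring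
  have hnorm : ∑ z, margT2 π ε P0 P1 d u v w z * Gd α z ^ 2
      = ∑ z, Gd α z * ∑ y, massT2 π ε P0 P1 d u v w z.1 (extRow z.2 y) *
        ∑ β ∈ S, a β * chi β y := by
    have hlin : ∀ T : Finset (Finset (Fin R ⊕ Fin R)),
        ∑ z, Gd α z * ∑ y, massT2 π ε P0 P1 d u v w z.1 (extRow z.2 y) * ∑ β ∈ T, a β * chi β y
        = ∑ β ∈ T, a β *
          ∑ z, Gd α z * ∑ y, massT2 π ε P0 P1 d u v w z.1 (extRow z.2 y) * chi β y := by
      intro T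
      simp only [Finset.mul_sum]
      rw [Finset.sum_comm (s := T)]
      refine Finset.sum_congr rfl fun z _ => ?_
      rw [Finset.sum_comm]
      exact Finset.sum_congr rfl fun β _ => Finset.sum_congr rfl fun y _ => by ring
    calc ∑ z, margT2 π ε P0 P1 d u v w z * Gd α z ^ 2
        = ∑ α', ∑ z, margT2 π ε P0 P1 d u v w z * Gd α z * Gd α' z := by
          rw [Finset.sum_eq_single α (fun α' _ h => hortho α' h) (by simp)]
          exact Finset.sum_congr rfl fun z _ => by ring
      _ = ∑ z, Gd α z * ∑ y, massT2 π ε P0 P1 d u v w z.1 (extRow z.2 y) *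
            ∑ β, a β * chi β y := by
          rw [Finset.sum_comm]
          refine Finset.sum_congr rfl fun z _ => ?_
          rw [← Finset.mul_sum, hGsum, mul_comm (margT2 π ε P0 P1 d u v w z), mul_assoc,
            margT2_mul_markovT2 hfib hε1 hε2 h0 h1]
          simp only [sub_noiseT_eq, ha]
      _ = _ := by
          rw [hlin, hlin]
          exact (Finset.sum_subset (Finset.subset_univ S) fun β _ hβ => by
            rw [hchar β hβ, mul_zero]).symm
  have hcs := sq_sum_massT2_mul_le (u := u) (v := v) (w := w) hfib hk0 hε1 hε2 h0 h1 (Gd α) S a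
  rw [← hnorm] at hcs
  have hε : 0 ≤ 1 - ε := by linarith
  have hT : 0 ≤ ∑ β ∈ S, (1 - ε) ^ (ptil π u w β).card * a β ^ 2 :=
    Finset.sum_nonneg fun β _ => mul_nonneg (pow_nonneg hε _) (sq_nonneg _)
  refine le_trans (b := ∑ β ∈ S, (1 - ε) ^ (ptil π u w β).card * a β ^ 2) ?_ ?_
  · by_contra! hlt
    nlinarith
  · rw [Finset.mul_sum]
    refine Finset.sum_le_sum fun β hβ => ?_
    rw [(Finset.mem_filter.1 hβ).2]
    refine mul_le_mul_of_nonneg_left ?_ (pow_nonneg hε _)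
    have ht0 : 0 ≤ (1 - γ) ^ β.card := pow_nonneg (by linarith) _
    have ht1 : (1 - γ) ^ β.card ≤ 1 := pow_le_one₀ (by linarith) (by linarith)
    rw [ha, mul_pow, mul_comm 2, pow_mul]
    exact mul_le_mul_of_nonneg_right (by nlinarith) (sq_nonneg _)
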